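/- arXiv:2410.06740 — 3 statements merged into one kernel-verified Lean document; each statement's English description precedes it below -/
import Mathlib

section
/- Let n ≥ 2, let Ω ∈ ℝⁿ be a unit vector, let η ∈ ℝ, and let G_η(u) := e^{η(u·Ω)²}/Z_η with Z_η := ∫_{S^{n−1}} e^{η(v·Ω)²} dσ(v). Write P := Id − Ω⊗Ω, and set d₄₀ := ∫ (u·Ω)⁴ G_η dσ, d₂₂ := ∫ (u·Ω)²(1−(u·Ω)²) G_η dσ, d₀₄ := ∫ (1−(u·Ω)²)² G_η dσ, and Γ_{ijkl} := P_{ij}P_{kl} + P_{ik}P_{jl} + P_{il}P_{jk}. Then for all i, j, k, l ∈ {1,…,n}: ∫_{S^{n−1}} u_i u_j u_k u_l G_η(u) dσ(u) = d₄₀ Ω_i Ω_j Ω_k Ω_l + (d₂₂/(n−1)) ( P_{ij}Ω_kΩ_l + P_{ik}Ω_jΩ_l + P_{il}Ω_jΩ_k + P_{jk}Ω_iΩ_l + P_{jl}Ω_iΩ_k + P_{kl}Ω_iΩ_j ) + (d₀₄/((n−1)(n+1))) Γ_{ijkl}. -/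
open MeasureTheory Metric
open scoped RealInnerProductSpace

/-- The image of a point of the unit sphere of `ℝⁿ` under a linear isometry. -/
noncomputable def sphereMap {n : ℕ}
    (e : EuclideanSpace ℝ (Fin n) ≃ₗᵢ[ℝ] EuclideanSpace ℝ (Fin n))
    (u : sphere (0 : EuclideanSpace ℝ (Fin n)) 1) :
    sphere (0 : EuclideanSpace ℝ (Fin n)) 1 :=
  ⟨e u, by
    rw [mem_sphere_zero_iff_norm, e.norm_map]
    exact mem_sphere_zero_iff_norm.mp u.2⟩

/-- A measure on the unit sphere of `ℝⁿ` is rotation invariant if it is invariant under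
every linear isometry of `ℝⁿ`. -/
def RotationInvariant {n : ℕ} (σ : Measure (sphere (0 : EuclideanSpace ℝ (Fin n)) 1)) :
    Prop :=
  ∀ e : EuclideanSpace ℝ (Fin n) ≃ₗᵢ[ℝ] EuclideanSpace ℝ (Fin n),
    σ.map (sphereMap e) = σ

/-- The Gibbs density `G_η(u) = e^{η(u·Ω)²}/Z_η` on the unit sphere, with
`Z_η = ∫ e^{η(v·Ω)²} dσ(v)`. -/
noncomputable def gibbs {n : ℕ} (σ : Measure (sphere (0 : EuclideanSpace ℝ (Fin n)) 1))
    (η : ℝ) (Ω : EuclideanSpace ℝ (Fin n))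
    (u : sphere (0 : EuclideanSpace ℝ (Fin n)) 1) : ℝ :=
  Real.exp (η * ⟪(u : EuclideanSpace ℝ (Fin n)), Ω⟫ ^ 2) /
    ∫ v : sphere (0 : EuclideanSpace ℝ (Fin n)) 1,
      Real.exp (η * ⟪(v : EuclideanSpace ℝ (Fin n)), Ω⟫ ^ 2) ∂σ

/-- The `(i,j)` entry of the orthogonal projection matrix `P = Id − Ω⊗Ω` onto `Ω⊥`. -/
noncomputable def projEntry {n : ℕ} (Ω : EuclideanSpace ℝ (Fin n)) (i j : Fin n) : ℝ :=
  (if i = j then (1 : ℝ) else 0) - Ω i * Ω j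


section Helpers

abbrev ESp (n : ℕ) := EuclideanSpace ℝ (Fin n)
abbrev Sph (n : ℕ) := sphere (0 : EuclideanSpace ℝ (Fin n)) 1

/-- The function `u ↦ u·y` on the sphere. -/
noncomputable def ipc {n : ℕ} (y : ESp n) : C(Sph n, ℝ) :=
  ⟨fun u => ⟪(u : ESp n), y⟫, by fun_prop⟩

lemma ipc_apply {n : ℕ} (y : ESp n) (u : Sph n) : ipc y u = ⟪(u : ESp n), y⟫ := rfl

lemma ipc_add {n : ℕ} (x y : ESp n) : ipc (x + y) = ipc x + ipc y := by
  ext u; simp [ipc_apply, inner_add_right]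

lemma ipc_sub {n : ℕ} (x y : ESp n) : ipc (x - y) = ipc x - ipc y := by
  ext u; simp [ipc_apply, inner_sub_right]

lemma ipc_smul {n : ℕ} (c : ℝ) (y : ESp n) : ipc (c • y) = c • ipc y := by
  ext u; simp [ipc_apply, inner_smul_right]

lemma ipc_neg {n : ℕ} (y : ESp n) : ipc (-y) = - ipc y := by
  ext u; simp [ipc_apply, inner_neg_right]

lemma gibbs_continuous {n : ℕ} (σ : Measure (Sph n)) (η : ℝ) (Ω : ESp n) :
    Continuous (gibbs σ η Ω) := by
  unfold gibbs
  fun_prop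

lemma integrable_gibbs {n : ℕ} (σ : Measure (Sph n)) [IsProbabilityMeasure σ] (η : ℝ) (Ω : ESp n)
    (f : C(Sph n, ℝ)) : Integrable (fun u => f u * gibbs σ η Ω u) σ := by
  have hc : Continuous (fun u => f u * gibbs σ η Ω u) :=
    f.continuous.mul (gibbs_continuous σ η Ω)
  exact hc.integrable_of_hasCompactSupport (HasCompactSupport.of_compactSpace _)

/-- Gibbs average as a linear functional. -/
noncomputable def gL {n : ℕ} (σ : Measure (Sph n)) [IsProbabilityMeasure σ] (η : ℝ) (Ω : ESp n) :
    C(Sph n, ℝ) →ₗ[ℝ] ℝ where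
  toFun f := ∫ u, f u * gibbs σ η Ω u ∂σ
  map_add' f g := by
    rw [← integral_add (integrable_gibbs σ η Ω f) (integrable_gibbs σ η Ω g)]
    congr 1; ext u; simp [add_mul]
  map_smul' c f := by
    simp only [RingHom.id_apply, smul_eq_mul]
    rw [← integral_const_mul]
    congr 1; ext u; simp [mul_assoc]

lemma gL_apply {n : ℕ} (σ : Measure (Sph n)) [IsProbabilityMeasure σ] (η : ℝ) (Ω : ESp n)
    (f : C(Sph n, ℝ)) : gL σ η Ω f = ∫ u, f u * gibbs σ η Ω u ∂σ := rfl

lemma sphereMap_continuous {n : ℕ} (e : ESp n ≃ₗᵢ[ℝ] ESp n) : Continuous (sphereMap e) := by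
  unfold sphereMap
  exact Continuous.subtype_mk (e.continuous.comp continuous_subtype_val) _

lemma gL_inv {n : ℕ} (σ : Measure (Sph n)) [IsProbabilityMeasure σ] (hinv : RotationInvariant σ)
    (η : ℝ) (Ω : ESp n) (e : ESp n ≃ₗᵢ[ℝ] ESp n) (he : e Ω = Ω) (f g : C(Sph n, ℝ))
    (hfg : ∀ u, g u = f (sphereMap e u)) : gL σ η Ω f = gL σ η Ω g := by
  rw [gL_apply, gL_apply]
  conv_lhs => rw [← hinv e]
  have hc : Continuous (fun u => f u * gibbs (σ.map (sphereMap e)) η Ω u) :=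
    f.continuous.mul (gibbs_continuous _ η Ω)
  rw [integral_map (sphereMap_continuous e).measurable.aemeasurable hc.aestronglyMeasurable]
  congr 1; ext u
  rw [hfg, hinv e]
  have : ⟪((sphereMap e u : Sph n) : ESp n), Ω⟫ = ⟪(u : ESp n), Ω⟫ := by
    conv_lhs => rw [← he]
    exact e.inner_map_map _ _
  simp only [gibbs, this]

lemma exists_iso {n : ℕ} (Ω y z : ESp n) (hy : ⟪y, Ω⟫ = 0) (hz : ⟪z, Ω⟫ = 0) (h : ‖y‖ = ‖z‖) :
    ∃ e : ESp n ≃ₗᵢ[ℝ] ESp n, e Ω = Ω ∧ ∀ u, ⟪e u, y⟫ = ⟪u, z⟫ := by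
  refine ⟨(ℝ ∙ (z - y))ᗮ.reflection, ?_, ?_⟩
  · apply Submodule.reflection_mem_subspace_eq_self
    rw [Submodule.mem_orthogonal_singleton_iff_inner_right, inner_sub_left, hy, hz, sub_zero]
  · intro u
    have h0 := Submodule.reflection_sub h.symm
    generalize (ℝ ∙ (z - y))ᗮ.reflection = R at h0
    rw [← h0]
    exact LinearIsometryEquiv.inner_map_map _ _ _

variable {n : ℕ} (σ : Measure (Sph n)) [IsProbabilityMeasure σ] (hinv : RotationInvariant σ)
    (η : ℝ) (Ω : ESp n)

lemma gL_iso (hinv : RotationInvariant σ) (y z : ESp n) (hy : ⟪y, Ω⟫ = 0) (hz : ⟪z, Ω⟫ = 0)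
    (h : ‖y‖ = ‖z‖) (a b : ℕ) :
    gL σ η Ω (ipc Ω ^ a * ipc y ^ b) = gL σ η Ω (ipc Ω ^ a * ipc z ^ b) := by
  obtain ⟨e, he, h2⟩ := exists_iso Ω y z hy hz h
  apply gL_inv σ hinv η Ω e he
  intro u
  have h1 : ⟪e u, Ω⟫ = ⟪(u : ESp n), Ω⟫ := by
    conv_lhs => rw [← he]
    exact e.inner_map_map _ _
  simp only [ContinuousMap.mul_apply, ContinuousMap.pow_apply, ipc_apply, sphereMap, h1, h2]

lemma gL_moments (hn : 2 ≤ n) (hinv : RotationInvariant σ) (hΩ : ‖Ω‖ = 1) (y : ESp n)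
    (hy : ⟪y, Ω⟫ = 0) :
    gL σ η Ω (ipc Ω ^ 2 * ipc y ^ 2)
      = gL σ η Ω (ipc Ω ^ 2 * (1 - ipc Ω ^ 2)) / ((n : ℝ) - 1) * ‖y‖ ^ 2 ∧
    gL σ η Ω (ipc Ω ^ 0 * ipc y ^ 4)
      = 3 * (gL σ η Ω ((1 - ipc Ω ^ 2) ^ 2) / (((n : ℝ) - 1) * ((n : ℝ) + 1))) * ‖y‖ ^ 4 := by
  obtain ⟨m, rfl⟩ : ∃ m, n = m + 2 := ⟨n - 2, by omega⟩
  have hΩ0 : Ω ≠ 0 := by intro h; simp [h] at hΩ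
  have hfin : Module.finrank ℝ (ℝ ∙ Ω)ᗮ = m + 1 := by
    have : Fact (Module.finrank ℝ (ESp (m+2)) = (m + 1) + 1) := ⟨by simp⟩
    exact Submodule.finrank_orthogonal_span_singleton hΩ0
  let b : OrthonormalBasis (Fin (m+1)) ℝ (ℝ ∙ Ω)ᗮ :=
    (stdOrthonormalBasis ℝ (ℝ ∙ Ω)ᗮ).reindex (finCongr hfin)
  let v : Fin (m+1) → ESp (m+2) := fun p => (b p : ESp (m+2))
  have hvΩ : ∀ p, ⟪v p, Ω⟫ = 0 := fun p =>
    (Submodule.mem_orthogonal_singleton_iff_inner_left).1 (b p).2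
  have hvv : ∀ p q, ⟪v p, v q⟫ = if p = q then (1:ℝ) else 0 := by
    intro p q
    have := orthonormal_iff_ite.1 b.orthonormal p q
    simpa using this
  have hvn : ∀ p, ‖v p‖ = 1 := fun p => b.orthonormal.1 p
  have hsum : ∑ p, ipc (v p) ^ 2 = 1 - ipc Ω ^ 2 := by
    ext u
    have hu : ‖(u : ESp (m+2))‖ = 1 := mem_sphere_zero_iff_norm.mp u.2
    set t := ⟪(u : ESp (m+2)), Ω⟫ with ht
    have hmem : (u : ESp (m+2)) - t • Ω ∈ (ℝ ∙ Ω)ᗮ := by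
      rw [Submodule.mem_orthogonal_singleton_iff_inner_left, inner_sub_left, inner_smul_left,
        real_inner_self_eq_norm_sq, hΩ, ht]
      simp
    have h1 := b.sum_sq_norm_inner_right ⟨_, hmem⟩
    have h2 : ∀ p, ‖⟪b p, (⟨_, hmem⟩ : (ℝ ∙ Ω)ᗮ)⟫‖ ^ 2 = ⟪(u : ESp (m+2)), v p⟫ ^ 2 := by
      intro p
      rw [Submodule.coe_inner, Real.norm_eq_abs, sq_abs]
      change ⟪v p, (u : ESp (m+2)) - t • Ω⟫ ^ 2 = _
      rw [inner_sub_right, inner_smul_right, hvΩ, real_inner_comm]; ring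
    simp only [h2] at h1
    have h3 : ‖(⟨_, hmem⟩ : (ℝ ∙ Ω)ᗮ)‖ ^ 2 = 1 - t ^ 2 := by
      rw [Submodule.coe_norm]
      change ‖(u : ESp (m+2)) - t • Ω‖ ^ 2 = _
      rw [norm_sub_sq_real, inner_smul_right, norm_smul, hu, hΩ, ← ht, Real.norm_eq_abs, mul_one,
        sq_abs]; ring
    rw [h3] at h1
    simpa [ContinuousMap.sum_apply, ipc_apply] using h1
  -- isotropy
  have hiso : ∀ (z : ESp (m+2)), ⟪z, Ω⟫ = 0 → ∀ a k : ℕ,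
      gL σ η Ω (ipc Ω ^ a * ipc z ^ k) = ‖z‖ ^ k * gL σ η Ω (ipc Ω ^ a * ipc (v 0) ^ k) := by
    intro z hz a k
    rw [gL_iso σ η Ω hinv z (‖z‖ • v 0) hz (by rw [inner_smul_left, hvΩ, mul_zero])
      (by rw [norm_smul, hvn]; simp), ipc_smul, smul_pow, mul_smul_comm, map_smul, smul_eq_mul]
  set A := gL σ η Ω (ipc Ω ^ 2 * ipc (v 0) ^ 2) with hA
  set B := gL σ η Ω (ipc Ω ^ 0 * ipc (v 0) ^ 4) with hB
  have hAv : gL σ η Ω (ipc Ω ^ 2 * (1 - ipc Ω ^ 2)) = (m + 1) * A := by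
    rw [← hsum, Finset.mul_sum, map_sum]
    rw [Finset.sum_congr rfl (fun p _ => hiso (v p) (hvΩ p) 2 2)]
    simp [hvn, hA]
  have hC : ∀ p q, gL σ η Ω (ipc (v p) ^ 2 * ipc (v q) ^ 2) = (1 + if p = q then 2 else 0) * (B / 3) := by
    intro p q
    have e1 := hiso (v p) (hvΩ p) 0 4
    have e2 := hiso (v q) (hvΩ q) 0 4
    by_cases hpq : p = q
    · subst hpq
      rw [← hB, hvn] at e1
      rw [show ipc (v p) ^ 2 * ipc (v p) ^ 2 = ipc Ω ^ 0 * ipc (v p) ^ 4 by ring, e1]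
      simp; ring
    · have e3 := hiso (v p + v q) (by rw [inner_add_left, hvΩ, hvΩ, add_zero]) 0 4
      have e4 := hiso (v p - v q) (by rw [inner_sub_left, hvΩ, hvΩ, sub_zero]) 0 4
      have n3 : ‖v p + v q‖ ^ 4 = 4 := by
        have : ‖v p + v q‖ ^ 2 = 2 := by
          rw [norm_add_sq_real, hvv, hvn, hvn, if_neg hpq]; norm_num
        calc _ = (‖v p + v q‖ ^ 2) ^ 2 := by ring
          _ = 4 := by rw [this]; norm_num
      have n4 : ‖v p - v q‖ ^ 4 = 4 := by
        have : ‖v p - v q‖ ^ 2 = 2 := by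
          rw [norm_sub_sq_real, hvv, hvn, hvn, if_neg hpq]; norm_num
        calc _ = (‖v p - v q‖ ^ 2) ^ 2 := by ring
          _ = 4 := by rw [this]; norm_num
      rw [n3, ← hB] at e3
      rw [n4, ← hB] at e4
      rw [hvn, ← hB] at e1 e2
      have key : ipc Ω ^ 0 * ipc (v p + v q) ^ 4 + ipc Ω ^ 0 * ipc (v p - v q) ^ 4
          = (2:ℝ) • (ipc Ω ^ 0 * ipc (v p) ^ 4) + (2:ℝ) • (ipc Ω ^ 0 * ipc (v q) ^ 4)
            + (12:ℝ) • (ipc (v p) ^ 2 * ipc (v q) ^ 2) := by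
        rw [ipc_add, ipc_sub]
        ext u
        simp
        ring
      have key2 := congrArg (gL σ η Ω) key
      simp only [map_add, map_smul, e1, e2, e3, e4, smul_eq_mul] at key2
      rw [if_neg hpq]
      linarith
  have hBv : gL σ η Ω ((1 - ipc Ω ^ 2) ^ 2) = (m + 1) * (m + 3) * (B / 3) := by
    rw [← hsum, sq, Finset.sum_mul_sum, map_sum]
    simp only [map_sum, hC]
    simp only [← Finset.sum_mul, Finset.sum_add_distrib, Finset.sum_ite_eq]
    simp
    left
    ring
  rw [hiso y hy 2 2, hiso y hy 0 4, ← hA, ← hB, hAv, hBv]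
  push_cast
  have h1 : (m:ℝ) + 1 ≠ 0 := by positivity
  have h3 : (m:ℝ) + 3 ≠ 0 := by positivity
  have h1' : (m:ℝ) + 2 - 1 = m + 1 := by ring
  have h3' : (m:ℝ) + 2 + 1 = m + 3 := by ring
  rw [h1', h3']
  constructor
  · field_simp
  · field_simp

lemma gL_quartic (hn : 2 ≤ n) (hinv : RotationInvariant σ) (hΩ : ‖Ω‖ = 1) (x : ESp n) :
    gL σ η Ω (ipc x ^ 4) = gL σ η Ω (ipc Ω ^ 4) * ⟪x, Ω⟫ ^ 4
      + 6 * (gL σ η Ω (ipc Ω ^ 2 * (1 - ipc Ω ^ 2)) / ((n : ℝ) - 1))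
          * (⟪x, x⟫ - ⟪x, Ω⟫ ^ 2) * ⟪x, Ω⟫ ^ 2
      + 3 * (gL σ η Ω ((1 - ipc Ω ^ 2) ^ 2) / (((n : ℝ) - 1) * ((n : ℝ) + 1)))
          * (⟪x, x⟫ - ⟪x, Ω⟫ ^ 2) ^ 2 := by
  set s := ⟪x, Ω⟫ with hs
  set y := x - s • Ω with hy
  have hyΩ : ⟪y, Ω⟫ = 0 := by
    rw [hy, inner_sub_left, inner_smul_left, real_inner_self_eq_norm_sq, hΩ, hs]; simp
  have hyn : ‖y‖ ^ 2 = ⟪x, x⟫ - s ^ 2 := by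
    rw [hy, norm_sub_sq_real, inner_smul_right, norm_smul, hΩ, ← hs, Real.norm_eq_abs, mul_one,
        sq_abs, real_inner_self_eq_norm_sq]; ring
  have hyn4 : ‖y‖ ^ 4 = (⟪x, x⟫ - s ^ 2) ^ 2 := by rw [← hyn]; ring
  obtain ⟨m2, m4⟩ := gL_moments σ η Ω hn hinv hΩ y hyΩ
  have hodd : ∀ a k : ℕ, Odd k → gL σ η Ω (ipc Ω ^ a * ipc y ^ k) = 0 := by
    intro a k hk
    have h := gL_iso σ η Ω hinv y (-y) hyΩ (by rw [inner_neg_left, hyΩ, neg_zero])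
      (norm_neg y).symm a k
    rw [ipc_neg, hk.neg_pow, mul_neg, map_neg] at h
    linarith
  have hx : x = s • Ω + y := by rw [hy]; abel
  have key : ipc x ^ 4 = (s ^ 4) • ipc Ω ^ 4 + (4 * s ^ 3) • (ipc Ω ^ 3 * ipc y ^ 1)
      + (6 * s ^ 2) • (ipc Ω ^ 2 * ipc y ^ 2) + (4 * s) • (ipc Ω ^ 1 * ipc y ^ 3)
      + ipc Ω ^ 0 * ipc y ^ 4 := by
    have : ipc x = s • ipc Ω + ipc y := by rw [← ipc_smul, ← ipc_add, ← hx]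
    rw [this]
    ext u
    simp
    ring
  rw [key]
  simp only [map_add, map_smul, smul_eq_mul]
  rw [hodd 3 1 (by decide), hodd 1 3 (by decide), m2, m4, hyn, hyn4]
  ring

lemma gL_polar (hn : 2 ≤ n) (hinv : RotationInvariant σ) (hΩ : ‖Ω‖ = 1) (a b c d : ESp n) :
    gL σ η Ω (ipc a * ipc b * ipc c * ipc d) =
      gL σ η Ω (ipc Ω ^ 4) * (⟪a, Ω⟫ * ⟪b, Ω⟫ * ⟪c, Ω⟫ * ⟪d, Ω⟫)
      + (gL σ η Ω (ipc Ω ^ 2 * (1 - ipc Ω ^ 2)) / ((n : ℝ) - 1)) *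
        ((⟪a, b⟫ - ⟪a, Ω⟫ * ⟪b, Ω⟫) * ⟪c, Ω⟫ * ⟪d, Ω⟫
        + (⟪a, c⟫ - ⟪a, Ω⟫ * ⟪c, Ω⟫) * ⟪b, Ω⟫ * ⟪d, Ω⟫
        + (⟪a, d⟫ - ⟪a, Ω⟫ * ⟪d, Ω⟫) * ⟪b, Ω⟫ * ⟪c, Ω⟫
        + (⟪b, c⟫ - ⟪b, Ω⟫ * ⟪c, Ω⟫) * ⟪a, Ω⟫ * ⟪d, Ω⟫
        + (⟪b, d⟫ - ⟪b, Ω⟫ * ⟪d, Ω⟫) * ⟪a, Ω⟫ * ⟪c, Ω⟫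
        + (⟪c, d⟫ - ⟪c, Ω⟫ * ⟪d, Ω⟫) * ⟪a, Ω⟫ * ⟪b, Ω⟫)
      + (gL σ η Ω ((1 - ipc Ω ^ 2) ^ 2) / (((n : ℝ) - 1) * ((n : ℝ) + 1))) *
        ((⟪a, b⟫ - ⟪a, Ω⟫ * ⟪b, Ω⟫) * (⟪c, d⟫ - ⟪c, Ω⟫ * ⟪d, Ω⟫)
        + (⟪a, c⟫ - ⟪a, Ω⟫ * ⟪c, Ω⟫) * (⟪b, d⟫ - ⟪b, Ω⟫ * ⟪d, Ω⟫)
        + (⟪a, d⟫ - ⟪a, Ω⟫ * ⟪d, Ω⟫) * (⟪b, c⟫ - ⟪b, Ω⟫ * ⟪c, Ω⟫)) := by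
  have key : (192 : ℝ) • (ipc a * ipc b * ipc c * ipc d) =
      ipc (a + b + c + d) ^ 4 - ipc (a + b + c - d) ^ 4 - ipc (a + b - c + d) ^ 4
      + ipc (a + b - c - d) ^ 4 - ipc (a - b + c + d) ^ 4 + ipc (a - b + c - d) ^ 4
      + ipc (a - b - c + d) ^ 4 - ipc (a - b - c - d) ^ 4 := by
    simp only [ipc_add, ipc_sub]
    ext u
    simp
    ring
  have key2 := congrArg (gL σ η Ω) key
  have hq := gL_quartic σ η Ω hn hinv hΩ
  obtain ⟨D, hD⟩ : ∃ D, D = gL σ η Ω (ipc Ω ^ 4) := ⟨_, rfl⟩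
  simp only [← hD] at hq ⊢
  simp only [map_add, map_sub, map_smul, smul_eq_mul, hq] at key2
  simp only [inner_add_left, inner_sub_left, inner_add_right, inner_sub_right] at key2
  rw [real_inner_comm a b, real_inner_comm a c, real_inner_comm a d, real_inner_comm b c,
    real_inner_comm b d, real_inner_comm c d] at key2
  refine mul_left_cancel₀ (by norm_num : (192:ℝ) ≠ 0) ?_
  rw [key2]
  generalize gL σ η Ω (ipc Ω ^ 2 * (1 - ipc Ω ^ 2)) / ((n : ℝ) - 1) = D2
  generalize gL σ η Ω ((1 - ipc Ω ^ 2) ^ 2) / (((n : ℝ) - 1) * ((n : ℝ) + 1)) = D0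
  ring

end Helpers

/-- The fourth-moment tensor of the Gibbs density:
`∫ u_i u_j u_k u_l G_η dσ = d₄₀ Ω_iΩ_jΩ_kΩ_l + (d₂₂/(n−1)) (six P⊗Ω⊗Ω terms)
+ (d₀₄/((n−1)(n+1))) Γ_{ijkl}` with `Γ_{ijkl} = P_{ij}P_{kl} + P_{ik}P_{jl} + P_{il}P_{jk}`. -/
theorem gibbs_H4_tensor (n : ℕ) (hn : 2 ≤ n)
    (σ : Measure (sphere (0 : EuclideanSpace ℝ (Fin n)) 1))
    (hprob : IsProbabilityMeasure σ) (hinv : RotationInvariant σ)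
    (Ω : EuclideanSpace ℝ (Fin n)) (hΩ : ‖Ω‖ = 1) (η : ℝ) :
    ∀ i j k l : Fin n,
      (∫ u : sphere (0 : EuclideanSpace ℝ (Fin n)) 1,
          (u : EuclideanSpace ℝ (Fin n)) i * (u : EuclideanSpace ℝ (Fin n)) j *
            (u : EuclideanSpace ℝ (Fin n)) k * (u : EuclideanSpace ℝ (Fin n)) l *
            gibbs σ η Ω u ∂σ)
        = (∫ u : sphere (0 : EuclideanSpace ℝ (Fin n)) 1,
              ⟪(u : EuclideanSpace ℝ (Fin n)), Ω⟫ ^ 4 * gibbs σ η Ω u ∂σ) *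
            (Ω i * Ω j * Ω k * Ω l)
          + ((∫ u : sphere (0 : EuclideanSpace ℝ (Fin n)) 1,
                ⟪(u : EuclideanSpace ℝ (Fin n)), Ω⟫ ^ 2 *
                  (1 - ⟪(u : EuclideanSpace ℝ (Fin n)), Ω⟫ ^ 2) * gibbs σ η Ω u ∂σ) /
              ((n : ℝ) - 1)) *
            (projEntry Ω i j * Ω k * Ω l + projEntry Ω i k * Ω j * Ω l
              + projEntry Ω i l * Ω j * Ω k + projEntry Ω j k * Ω i * Ω l
              + projEntry Ω j l * Ω i * Ω k + projEntry Ω k l * Ω i * Ω j)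
          + ((∫ u : sphere (0 : EuclideanSpace ℝ (Fin n)) 1,
                (1 - ⟪(u : EuclideanSpace ℝ (Fin n)), Ω⟫ ^ 2) ^ 2 * gibbs σ η Ω u ∂σ) /
              (((n : ℝ) - 1) * ((n : ℝ) + 1))) *
            (projEntry Ω i j * projEntry Ω k l + projEntry Ω i k * projEntry Ω j l
              + projEntry Ω i l * projEntry Ω j k) := by
  intro i j k l
  have := hprob
  have h := gL_polar σ η Ω hn hinv hΩ (EuclideanSpace.single i 1) (EuclideanSpace.single j 1)
    (EuclideanSpace.single k 1) (EuclideanSpace.single l 1)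
  have hip : ∀ (p : Fin n) (x : ESp n), ⟪EuclideanSpace.single p (1:ℝ), x⟫ = x p := by
    intro p x; simp [EuclideanSpace.inner_single_left]
  have hip' : ∀ (p : Fin n) (x : ESp n), ⟪x, EuclideanSpace.single p (1:ℝ)⟫ = x p := by
    intro p x; simp [EuclideanSpace.inner_single_right]
  have hpe : ∀ p q : Fin n, (EuclideanSpace.single q (1:ℝ) : ESp n) p - Ω p * Ω q
      = projEntry Ω p q := by
    intro p q; simp [projEntry]
  simp only [hip, hpe] at h
  simp only [gL_apply, ContinuousMap.mul_apply, ContinuousMap.pow_apply, ContinuousMap.sub_apply,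
    ContinuousMap.one_apply, ipc_apply, hip'] at h
  exact h
end

section
/- Let n ≥ 2. Let ρ, η : ℝ → ℝ be differentiable, let Ω : ℝ → ℝⁿ be differentiable with |Ω(t)| = 1 for all t, and let h : [−1,1] → ℝ be continuous and odd. For t ∈ ℝ and u ∈ S^{n−1} define G(t,u) := e^{η(t)(u·Ω(t))²}/Z(t) with Z(t) := ∫_{S^{n−1}} e^{η(t)(v·Ω(t))²} dσ(v), and ψ(t,u) := h(u·Ω(t)) (u − (u·Ω(t))Ω(t)). Then for every t the map s ↦ ρ(s)G(s,u) is differentiable at t for each u, and ∫_{S^{n−1}} ∂_t(ρ(t)G(t,u)) ψ(t,u) dσ(u) = (2 η(t) c(t)/(n−1)) ρ(t) Ω′(t), where c(t) := ∫_{S^{n−1}} (u·Ω(t)) h(u·Ω(t)) (1 − (u·Ω(t))²) G(t,u) dσ(u). -/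
open MeasureTheory Metric
open scoped RealInnerProductSpace

section Helpers

variable {n : ℕ}



theorem integrable_sphere (σ : Measure (sphere (0 : EuclideanSpace ℝ (Fin n)) 1))
    [IsProbabilityMeasure σ] {F : Type*} [NormedAddCommGroup F]
    {f : sphere (0 : EuclideanSpace ℝ (Fin n)) 1 → F} (hf : Continuous f) :
    Integrable f σ :=
  hf.integrable_of_hasCompactSupport (HasCompactSupport.of_compactSpace f)

theorem continuous_sphereMap
    (e : EuclideanSpace ℝ (Fin n) ≃ₗᵢ[ℝ] EuclideanSpace ℝ (Fin n)) :
    Continuous (sphereMap e) :=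
  Continuous.subtype_mk (e.continuous.comp continuous_subtype_val) _

theorem integral_rot_inv (σ : Measure (sphere (0 : EuclideanSpace ℝ (Fin n)) 1))
    (hinv : RotationInvariant σ)
    (e : EuclideanSpace ℝ (Fin n) ≃ₗᵢ[ℝ] EuclideanSpace ℝ (Fin n))
    (F : ℝ → ℝ → ℝ) (w x : EuclideanSpace ℝ (Fin n))
    (hF : Continuous fun u : sphere (0 : EuclideanSpace ℝ (Fin n)) 1 =>
      F ⟪(u : EuclideanSpace ℝ (Fin n)), e w⟫ ⟪(u : EuclideanSpace ℝ (Fin n)), e x⟫) :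
    ∫ u, F ⟪(u : EuclideanSpace ℝ (Fin n)), e w⟫ ⟪(u : EuclideanSpace ℝ (Fin n)), e x⟫ ∂σ
      = ∫ u, F ⟪(u : EuclideanSpace ℝ (Fin n)), w⟫ ⟪(u : EuclideanSpace ℝ (Fin n)), x⟫ ∂σ := by
  conv_lhs => rw [← hinv e]
  rw [integral_map (continuous_sphereMap e).measurable.aemeasurable
    hF.aestronglyMeasurable]
  simp only [sphereMap, LinearIsometryEquiv.inner_map_map]

theorem inner_mem_Icc (w : EuclideanSpace ℝ (Fin n)) (hw : ‖w‖ = 1)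
    (u : sphere (0 : EuclideanSpace ℝ (Fin n)) 1) :
    ⟪(u : EuclideanSpace ℝ (Fin n)), w⟫ ∈ Set.Icc (-1 : ℝ) 1 := by
  have h1 := abs_real_inner_le_norm (u : EuclideanSpace ℝ (Fin n)) w
  rw [hw, mem_sphere_zero_iff_norm.mp u.2, mul_one] at h1
  exact abs_le.mp h1

theorem continuous_inner_sphere (w : EuclideanSpace ℝ (Fin n)) :
    Continuous fun u : sphere (0 : EuclideanSpace ℝ (Fin n)) 1 =>
      ⟪(u : EuclideanSpace ℝ (Fin n)), w⟫ := by fun_prop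

theorem continuous_comp_inner (w : EuclideanSpace ℝ (Fin n)) (hw : ‖w‖ = 1)
    {k : ℝ → ℝ} (hk : ContinuousOn k (Set.Icc (-1) 1)) :
    Continuous fun u : sphere (0 : EuclideanSpace ℝ (Fin n)) 1 =>
      k ⟪(u : EuclideanSpace ℝ (Fin n)), w⟫ :=
  hk.comp_continuous (continuous_inner_sphere w) (inner_mem_Icc w hw)

/-- odd moments vanish -/
theorem odd_zero (σ : Measure (sphere (0 : EuclideanSpace ℝ (Fin n)) 1))
    (hinv : RotationInvariant σ)
    (w x : EuclideanSpace ℝ (Fin n)) (hw : ‖w‖ = 1) (hx : ⟪w, x⟫ = 0)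
    {k : ℝ → ℝ} (hk : ContinuousOn k (Set.Icc (-1) 1)) :
    ∫ u, k ⟪(u : EuclideanSpace ℝ (Fin n)), w⟫ * ⟪(u : EuclideanSpace ℝ (Fin n)), x⟫ ∂σ = 0 := by
  set e := (Submodule.span ℝ {x})ᗮ.reflection
  have hew : e w = w := by
    apply Submodule.reflection_mem_subspace_eq_self
    rw [Submodule.mem_orthogonal_singleton_iff_inner_left]; exact hx
  have hex : e x = -x := Submodule.reflection_orthogonalComplement_singleton_eq_neg x
  have := integral_rot_inv σ hinv e (fun a b => k a * b) w x (by
    rw [hew]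
    exact (continuous_comp_inner w hw hk).mul (continuous_inner_sphere _))
  simp only [hew, hex, inner_neg_right, mul_neg, integral_neg] at this
  linarith

theorem Q_eq (σ : Measure (sphere (0 : EuclideanSpace ℝ (Fin n)) 1))
    (hinv : RotationInvariant σ)
    (w x z : EuclideanSpace ℝ (Fin n)) (hw : ‖w‖ = 1) (hx : ⟪w, x⟫ = 0) (hz : ⟪w, z⟫ = 0)
    (hxz : ‖x‖ = ‖z‖)
    {k : ℝ → ℝ} (hk : ContinuousOn k (Set.Icc (-1) 1)) :
    ∫ u, k ⟪(u : EuclideanSpace ℝ (Fin n)), w⟫ * ⟪(u : EuclideanSpace ℝ (Fin n)), z⟫ ^ 2 ∂σ =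
    ∫ u, k ⟪(u : EuclideanSpace ℝ (Fin n)), w⟫ * ⟪(u : EuclideanSpace ℝ (Fin n)), x⟫ ^ 2 ∂σ := by
  set e := (Submodule.span ℝ {x - z})ᗮ.reflection
  have hew : e w = w := by
    apply Submodule.reflection_mem_subspace_eq_self
    rw [Submodule.mem_orthogonal_singleton_iff_inner_left, inner_sub_right, hx, hz, sub_zero]
  have hex : e x = z := Submodule.reflection_sub hxz
  have := integral_rot_inv σ hinv e (fun a b => k a * b ^ 2) w x (by
    rw [hew]
    exact (continuous_comp_inner w hw hk).mul ((continuous_inner_sphere _).pow 2))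
  simpa only [hew, hex] using this

theorem Z_eq (σ : Measure (sphere (0 : EuclideanSpace ℝ (Fin n)) 1))
    (hinv : RotationInvariant σ)
    (x z : EuclideanSpace ℝ (Fin n)) (hxz : ‖x‖ = ‖z‖) (a : ℝ) :
    ∫ u : sphere (0 : EuclideanSpace ℝ (Fin n)) 1,
      Real.exp (a * ⟪(u : EuclideanSpace ℝ (Fin n)), z⟫ ^ 2) ∂σ =
    ∫ u : sphere (0 : EuclideanSpace ℝ (Fin n)) 1,
      Real.exp (a * ⟪(u : EuclideanSpace ℝ (Fin n)), x⟫ ^ 2) ∂σ := by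
  set e := (Submodule.span ℝ {x - z})ᗮ.reflection
  have hex : e x = z := Submodule.reflection_sub hxz
  have := integral_rot_inv σ hinv e (fun a' _ => Real.exp (a * a' ^ 2)) x x (by fun_prop)
  simpa only [hex] using this

theorem Q_diag (hn : 2 ≤ n) (σ : Measure (sphere (0 : EuclideanSpace ℝ (Fin n)) 1))
    [IsProbabilityMeasure σ] (hinv : RotationInvariant σ)
    (w x : EuclideanSpace ℝ (Fin n)) (hw : ‖w‖ = 1) (hx : ⟪w, x⟫ = 0)
    {k : ℝ → ℝ} (hk : ContinuousOn k (Set.Icc (-1) 1)) :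
    ((n : ℝ) - 1) *
    ∫ u, k ⟪(u : EuclideanSpace ℝ (Fin n)), w⟫ * ⟪(u : EuclideanSpace ℝ (Fin n)), x⟫ ^ 2 ∂σ =
    ‖x‖ ^ 2 * ∫ u, k ⟪(u : EuclideanSpace ℝ (Fin n)), w⟫ *
      (1 - ⟪(u : EuclideanSpace ℝ (Fin n)), w⟫ ^ 2) ∂σ := by
  have hn0 : 0 < n := by omega
  obtain ⟨b, hb⟩ := Orthonormal.exists_orthonormalBasis_extension_of_card_eq
    (𝕜 := ℝ) (E := EuclideanSpace ℝ (Fin n)) (ι := Fin n) (by simp)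
    (v := fun _ => w) (s := {⟨0, hn0⟩}) (by
      rw [orthonormal_iff_ite]
      rintro ⟨i, hi⟩ ⟨j, hj⟩
      rw [Set.mem_singleton_iff] at hi hj
      subst hi; subst hj
      simp [hw])
  set i0 : Fin n := ⟨0, hn0⟩
  have hb0 : b i0 = w := hb i0 rfl
  have hsum : ∀ u : sphere (0 : EuclideanSpace ℝ (Fin n)) 1,
      ∑ i ∈ Finset.univ.erase i0, ⟪(u : EuclideanSpace ℝ (Fin n)), b i⟫ ^ 2
        = 1 - ⟪(u : EuclideanSpace ℝ (Fin n)), w⟫ ^ 2 := by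
    intro u
    have h1 := b.sum_sq_inner_left (u : EuclideanSpace ℝ (Fin n))
    rw [mem_sphere_zero_iff_norm.mp u.2, ← Finset.add_sum_erase _ _ (Finset.mem_univ i0), hb0] at h1
    linarith
  have hQ : ∀ i ∈ Finset.univ.erase i0,
      ∫ u, k ⟪(u : EuclideanSpace ℝ (Fin n)), w⟫ * ⟪(u : EuclideanSpace ℝ (Fin n)), x⟫ ^ 2 ∂σ =
      ‖x‖ ^ 2 * ∫ u, k ⟪(u : EuclideanSpace ℝ (Fin n)), w⟫ *
        ⟪(u : EuclideanSpace ℝ (Fin n)), b i⟫ ^ 2 ∂σ := by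
    intro i hi
    have hwi : ⟪w, b i⟫ = 0 := by
      rw [← hb0]
      exact b.orthonormal.2 (Finset.ne_of_mem_erase hi).symm
    rw [Q_eq σ hinv w (‖x‖ • b i) x hw (by rw [inner_smul_right, hwi, mul_zero]) hx
      (by rw [norm_smul, b.orthonormal.1 i]; simp) hk, ← integral_const_mul]
    congr 1
    ext u
    rw [inner_smul_right]; ring
  have hcard : (((Finset.univ.erase i0).card : ℕ) : ℝ) = (n : ℝ) - 1 := by
    rw [Finset.card_erase_of_mem (Finset.mem_univ _)]
    simp [Nat.cast_sub (show 1 ≤ n by omega)]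
  rw [← hcard, ← nsmul_eq_mul, ← Finset.sum_const, Finset.sum_congr rfl hQ, ← Finset.mul_sum,
    ← integral_finsetSum]
  · congr 2
    ext u
    rw [← Finset.mul_sum, hsum]
  · intro i _
    exact integrable_sphere σ
      ((continuous_comp_inner w hw hk).mul ((continuous_inner_sphere _).pow 2))

theorem Q_bilin (hn : 2 ≤ n) (σ : Measure (sphere (0 : EuclideanSpace ℝ (Fin n)) 1))
    [IsProbabilityMeasure σ] (hinv : RotationInvariant σ)
    (w x z : EuclideanSpace ℝ (Fin n)) (hw : ‖w‖ = 1) (hx : ⟪w, x⟫ = 0) (hz : ⟪w, z⟫ = 0)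
    {k : ℝ → ℝ} (hk : ContinuousOn k (Set.Icc (-1) 1)) :
    ((n : ℝ) - 1) *
    ∫ u, k ⟪(u : EuclideanSpace ℝ (Fin n)), w⟫ * (⟪(u : EuclideanSpace ℝ (Fin n)), x⟫ *
      ⟪(u : EuclideanSpace ℝ (Fin n)), z⟫) ∂σ =
    ⟪x, z⟫ * ∫ u, k ⟪(u : EuclideanSpace ℝ (Fin n)), w⟫ *
      (1 - ⟪(u : EuclideanSpace ℝ (Fin n)), w⟫ ^ 2) ∂σ := by
  have h1 := Q_diag hn σ hinv w (x + z) hw (by rw [inner_add_right, hx, hz, add_zero]) hk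
  have h2 := Q_diag hn σ hinv w (x - z) hw (by rw [inner_sub_right, hx, hz, sub_zero]) hk
  have hi : ∀ y : EuclideanSpace ℝ (Fin n), Integrable (fun u : sphere (0 : EuclideanSpace ℝ (Fin n)) 1 =>
      k ⟪(u : EuclideanSpace ℝ (Fin n)), w⟫ * ⟪(u : EuclideanSpace ℝ (Fin n)), y⟫ ^ 2) σ :=
    fun y => integrable_sphere σ
      ((continuous_comp_inner w hw hk).mul ((continuous_inner_sphere _).pow 2))
  have h3 : 4 * ∫ u, k ⟪(u : EuclideanSpace ℝ (Fin n)), w⟫ * (⟪(u : EuclideanSpace ℝ (Fin n)), x⟫ *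
      ⟪(u : EuclideanSpace ℝ (Fin n)), z⟫) ∂σ =
      ∫ u, k ⟪(u : EuclideanSpace ℝ (Fin n)), w⟫ * ⟪(u : EuclideanSpace ℝ (Fin n)), x + z⟫ ^ 2 ∂σ -
      ∫ u, k ⟪(u : EuclideanSpace ℝ (Fin n)), w⟫ * ⟪(u : EuclideanSpace ℝ (Fin n)), x - z⟫ ^ 2 ∂σ := by
    rw [← integral_sub (hi _) (hi _), ← integral_const_mul]
    congr 1
    ext u
    rw [inner_add_right, inner_sub_right]; ring
  have h4 : ‖x + z‖ ^ 2 - ‖x - z‖ ^ 2 = 4 * ⟪x, z⟫ := by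
    rw [norm_add_sq_real, norm_sub_sq_real]; ring
  linear_combination (((n : ℝ) - 1) / 4) * h3 + h1 / 4 - h2 / 4 + (∫ u, k ⟪(u : EuclideanSpace ℝ (Fin n)), w⟫ *
      (1 - ⟪(u : EuclideanSpace ℝ (Fin n)), w⟫ ^ 2) ∂σ) / 4 * h4

theorem Z_diff (σ : Measure (sphere (0 : EuclideanSpace ℝ (Fin n)) 1))
    [IsProbabilityMeasure σ] (w : EuclideanSpace ℝ (Fin n)) :
    Differentiable ℝ fun a : ℝ => ∫ u : sphere (0 : EuclideanSpace ℝ (Fin n)) 1,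
      Real.exp (a * ⟪(u : EuclideanSpace ℝ (Fin n)), w⟫ ^ 2) ∂σ := by
  intro a
  have hset : ProbabilityTheory.integrableExpSet
      (fun u : sphere (0 : EuclideanSpace ℝ (Fin n)) 1 => ⟪(u : EuclideanSpace ℝ (Fin n)), w⟫ ^ 2) σ
      = Set.univ := by
    ext b
    simp only [ProbabilityTheory.integrableExpSet, Set.mem_ofPred_eq, Set.mem_univ, iff_true]
    exact integrable_sphere σ (by fun_prop)
  exact ProbabilityTheory.differentiableAt_mgf (X :=
    (fun u : sphere (0 : EuclideanSpace ℝ (Fin n)) 1 => ⟪(u : EuclideanSpace ℝ (Fin n)), w⟫ ^ 2))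
    (μ := σ) (t := a) (by rw [hset]; simp)

end Helpers

/-- The term `I₁ = ∫ ∂_t(ρ G_{ηA_Ω}) ψ dσ = (2η c₁₂/(n−1)) ρ ∂_tΩ`, where
`ψ = h(u·Ω) P_{Ω⊥}u` is the Generalized Collision Invariant with `h` odd. -/
theorem time_derivative_I1 (n : ℕ) (hn : 2 ≤ n)
    (σ : Measure (sphere (0 : EuclideanSpace ℝ (Fin n)) 1))
    (hprob : IsProbabilityMeasure σ) (hinv : RotationInvariant σ)
    (ρ η : ℝ → ℝ) (hρ : Differentiable ℝ ρ) (hη : Differentiable ℝ η)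
    (Ω : ℝ → EuclideanSpace ℝ (Fin n)) (hΩdiff : Differentiable ℝ Ω)
    (hΩ : ∀ t, ‖Ω t‖ = 1)
    (h : ℝ → ℝ) (hcont : ContinuousOn h (Set.Icc (-1) 1))
    (hodd : ∀ r ∈ Set.Icc (-1 : ℝ) 1, h (-r) = -h r) :
    ∀ t : ℝ,
      (∀ u : sphere (0 : EuclideanSpace ℝ (Fin n)) 1,
        DifferentiableAt ℝ (fun s => ρ s * gibbs σ (η s) (Ω s) u) t)
      ∧ (∫ u : sphere (0 : EuclideanSpace ℝ (Fin n)) 1,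
            deriv (fun s => ρ s * gibbs σ (η s) (Ω s) u) t •
              (h ⟪(u : EuclideanSpace ℝ (Fin n)), Ω t⟫ •
                ((u : EuclideanSpace ℝ (Fin n))
                  - ⟪(u : EuclideanSpace ℝ (Fin n)), Ω t⟫ • Ω t)) ∂σ)
          = ((2 * η t *
                ∫ u : sphere (0 : EuclideanSpace ℝ (Fin n)) 1,
                  ⟪(u : EuclideanSpace ℝ (Fin n)), Ω t⟫ *
                    h ⟪(u : EuclideanSpace ℝ (Fin n)), Ω t⟫ *
                    (1 - ⟪(u : EuclideanSpace ℝ (Fin n)), Ω t⟫ ^ 2) *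
                    gibbs σ (η t) (Ω t) u ∂σ) /
              ((n : ℝ) - 1)) • (ρ t • deriv Ω t) := by
  intro t
  set w := Ω t with hwdef
  have hw : ‖w‖ = 1 := hΩ t
  set w' := deriv Ω t with hw'def
  have hΩ' : HasDerivAt Ω w' t := (hΩdiff t).hasDerivAt
  have hort : ⟪w, w'⟫ = 0 := by
    have h1 : HasDerivAt (fun s => ⟪Ω s, Ω s⟫) (⟪Ω t, w'⟫ + ⟪w', Ω t⟫) t := hΩ'.inner ℝ hΩ'
    have h2 : (fun s => ⟪Ω s, Ω s⟫) = fun _ => (1 : ℝ) := by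
      ext s; rw [real_inner_self_eq_norm_sq, hΩ s]; norm_num
    rw [h2] at h1
    have h3 := h1.unique (hasDerivAt_const t (1 : ℝ))
    rw [real_inner_comm (Ω t) w'] at h3
    linarith
  set F : ℝ → ℝ := fun a => ∫ u : sphere (0 : EuclideanSpace ℝ (Fin n)) 1,
      Real.exp (a * ⟪(u : EuclideanSpace ℝ (Fin n)), w⟫ ^ 2) ∂σ with hF
  have hFd : Differentiable ℝ F := Z_diff σ w
  have hFpos : ∀ a, 0 < F a := fun a =>
    integral_exp_pos (integrable_sphere σ (by fun_prop))
  have hgibbs : ∀ s u, gibbs σ (η s) (Ω s) u =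
      Real.exp (η s * ⟪(u : EuclideanSpace ℝ (Fin n)), Ω s⟫ ^ 2) / F (η s) := by
    intro s u
    rw [gibbs, Z_eq σ hinv w (Ω s) (by rw [hw, hΩ s])]
  have hZ : HasDerivAt (fun s => F (η s)) (deriv (fun s => F (η s)) t) t :=
    ((hFd _).comp t (hη t)).hasDerivAt
  set Z' := deriv (fun s => F (η s)) t
  set Z := F (η t) with hZdef
  have hZ0 : Z ≠ 0 := (hFpos _).ne'
  have hder : ∀ u : sphere (0 : EuclideanSpace ℝ (Fin n)) 1,
      HasDerivAt (fun s => ρ s * gibbs σ (η s) (Ω s) u)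
        ((deriv ρ t / Z - ρ t * Z' / Z ^ 2 + ρ t * deriv η t / Z *
            ⟪(u : EuclideanSpace ℝ (Fin n)), w⟫ ^ 2) *
            Real.exp (η t * ⟪(u : EuclideanSpace ℝ (Fin n)), w⟫ ^ 2) +
          2 * ρ t * η t * ⟪(u : EuclideanSpace ℝ (Fin n)), w⟫ *
            (Real.exp (η t * ⟪(u : EuclideanSpace ℝ (Fin n)), w⟫ ^ 2) / Z) *
            ⟪(u : EuclideanSpace ℝ (Fin n)), w'⟫) t := by
    intro u
    have hi : HasDerivAt (fun s => ⟪(u : EuclideanSpace ℝ (Fin n)), Ω s⟫)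
        ⟪(u : EuclideanSpace ℝ (Fin n)), w'⟫ t := by
      simpa using (hasDerivAt_const t (u : EuclideanSpace ℝ (Fin n))).inner ℝ hΩ'
    have h1 := (hρ t).hasDerivAt.mul
      ((((hη t).hasDerivAt.mul (hi.pow 2)).exp).div hZ (hFpos _).ne')
    simp only [hgibbs]
    refine h1.congr_deriv ?_
    simp only [Pi.mul_apply, Pi.pow_apply, Pi.div_apply, ← hwdef, ← hZdef]
    field_simp
    ring
  refine ⟨fun u => (hder u).differentiableAt, ?_⟩
  simp only [fun u => (hder u).deriv]
  have hg : ∀ u, gibbs σ (η t) w u =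
      Real.exp (η t * ⟪(u : EuclideanSpace ℝ (Fin n)), w⟫ ^ 2) / Z := fun u => hgibbs t u
  simp only [hg]
  set k1 : ℝ → ℝ := fun y => (deriv ρ t / Z - ρ t * Z' / Z ^ 2 + ρ t * deriv η t / Z * y ^ 2) *
            Real.exp (η t * y ^ 2) * h y with hk1
  set k2 : ℝ → ℝ := fun y => y * h y * (Real.exp (η t * y ^ 2) / Z) with hk2
  have hk1c : ContinuousOn k1 (Set.Icc (-1) 1) :=
    ContinuousOn.mul (Continuous.continuousOn (by fun_prop)) hcont
  have hk2c : ContinuousOn k2 (Set.Icc (-1) 1) :=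
    (continuousOn_id.mul hcont).mul (Continuous.continuousOn (by fun_prop))
  have hn1 : (n : ℝ) - 1 ≠ 0 := by
    have : (2 : ℝ) ≤ n := by exact_mod_cast hn
    linarith
  have hc1 := continuous_comp_inner w hw hk1c
  have hc2 := continuous_comp_inner w hw hk2c
  have hch := continuous_comp_inner w hw hcont
  refine ext_inner_left ℝ fun z => ?_
  have hcu : ∀ x : EuclideanSpace ℝ (Fin n),
      Continuous fun u : sphere (0 : EuclideanSpace ℝ (Fin n)) 1 =>
        ⟪(u : EuclideanSpace ℝ (Fin n)), x⟫ := continuous_inner_sphere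
  rw [← integral_inner (integrable_sphere σ (by
    exact Continuous.fun_smul (by fun_prop) (Continuous.fun_smul hch (by fun_prop))))]
  set z' := z - ⟪w, z⟫ • w with hz'
  have hwz' : ⟪w, z'⟫ = 0 := by
    rw [hz', inner_sub_right, inner_smul_right, real_inner_self_eq_norm_sq, hw]; ring
  have hA := odd_zero σ hinv w z' hw hwz' hk1c
  have hB := Q_bilin hn σ hinv w w' z' hw hort hwz' hk2c
  have hw'z : ⟪w', z'⟫ = ⟪z, w'⟫ := by
    rw [hz', inner_sub_right, inner_smul_right, real_inner_comm w w', hort,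
      real_inner_comm z w']; ring
  have hC : ∫ u : sphere (0 : EuclideanSpace ℝ (Fin n)) 1,
      ⟪(u : EuclideanSpace ℝ (Fin n)), w⟫ * h ⟪(u : EuclideanSpace ℝ (Fin n)), w⟫ *
        (1 - ⟪(u : EuclideanSpace ℝ (Fin n)), w⟫ ^ 2) *
        (Real.exp (η t * ⟪(u : EuclideanSpace ℝ (Fin n)), w⟫ ^ 2) / Z) ∂σ
      = ∫ u, k2 ⟪(u : EuclideanSpace ℝ (Fin n)), w⟫ *
      (1 - ⟪(u : EuclideanSpace ℝ (Fin n)), w⟫ ^ 2) ∂σ := by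
    congr 1
    ext u
    simp only [hk2]; ring
  rw [hC]
  set C := ∫ u, k2 ⟪(u : EuclideanSpace ℝ (Fin n)), w⟫ *
      (1 - ⟪(u : EuclideanSpace ℝ (Fin n)), w⟫ ^ 2) ∂σ
  rw [hw'z] at hB
  trans (∫ u, k1 ⟪(u : EuclideanSpace ℝ (Fin n)), w⟫ * ⟪(u : EuclideanSpace ℝ (Fin n)), z'⟫ ∂σ) +
    2 * ρ t * η t * ∫ u, k2 ⟪(u : EuclideanSpace ℝ (Fin n)), w⟫ *
      (⟪(u : EuclideanSpace ℝ (Fin n)), w'⟫ * ⟪(u : EuclideanSpace ℝ (Fin n)), z'⟫) ∂σ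
  · rw [← integral_const_mul, ← integral_add (integrable_sphere σ (by exact hc1.mul (hcu z')))
      (integrable_sphere σ (by exact continuous_const.mul (hc2.mul ((hcu w').mul (hcu z')))))]
    congr 1
    ext u
    simp only [hk1, hk2, hz', inner_smul_right, inner_sub_right]
    rw [real_inner_comm (u : EuclideanSpace ℝ (Fin n)) z, real_inner_comm w z]
    ring
  · rw [hA, inner_smul_right, inner_smul_right]
    generalize (∫ u, k2 ⟪(u : EuclideanSpace ℝ (Fin n)), w⟫ *
      (⟪(u : EuclideanSpace ℝ (Fin n)), w'⟫ * ⟪(u : EuclideanSpace ℝ (Fin n)), z'⟫) ∂σ) = q at hB ⊢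
    field_simp
    linear_combination (2 * ρ t * η t) * hB
end

section
/- Let n ≥ 2. Let ρ : ℝⁿ → ℝ be twice continuously differentiable, let η : ℝ → ℝ be continuously differentiable, let Ω : ℝⁿ → ℝⁿ be continuously differentiable with |Ω(x)| = 1 for all x, and let h : [−1,1] → ℝ be continuous and odd. For x ∈ ℝⁿ and u ∈ S^{n−1} define G(x,u) := e^{η(ρ(x))(u·Ω(x))²}/Z(x) with Z(x) := ∫_{S^{n−1}} e^{η(ρ(x))(v·Ω(x))²} dσ(v), and ψ(x,u) := h(u·Ω(x)) (u − (u·Ω(x))Ω(x)). Then at every x: ∫_{S^{n−1}} ∇_x·( (∇_xρ)(x) ρ(x) G(x,u) ) ψ(x,u) dσ(u) = (2 η(ρ(x)) c(x)/(n−1)) ρ(x) Σ_{j=1}^n ∂_{x_j}ρ(x) ∂_{x_j}Ω(x), where c(x) := ∫_{S^{n−1}} (u·Ω(x)) h(u·Ω(x)) (1 − (u·Ω(x))²) G(x,u) dσ(u) and ∇_x·(F) denotes the spatial divergence of the vector field F(x,u) at fixed u. -/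
open MeasureTheory Metric
open scoped RealInnerProductSpace

/-- Partial derivative `∂_{x_j} f(x)` of a scalar field on `ℝⁿ`. -/
noncomputable def pd {n : ℕ} (j : Fin n) (f : EuclideanSpace ℝ (Fin n) → ℝ)
    (x : EuclideanSpace ℝ (Fin n)) : ℝ :=
  fderiv ℝ f x (EuclideanSpace.single j 1)

/-- Partial derivative `∂_{x_j} f(x)` of a vector field on `ℝⁿ`. -/
noncomputable def pdV {n : ℕ} (j : Fin n)
    (f : EuclideanSpace ℝ (Fin n) → EuclideanSpace ℝ (Fin n))
    (x : EuclideanSpace ℝ (Fin n)) : EuclideanSpace ℝ (Fin n) :=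
  fderiv ℝ f x (EuclideanSpace.single j 1)

namespace DivAux

lemma integrable_cont {n : ℕ} {V : Type*} [NormedAddCommGroup V]
    [SecondCountableTopology V]
    (σ : Measure (sphere (0 : EuclideanSpace ℝ (Fin n)) 1)) [IsProbabilityMeasure σ]
    {φ : sphere (0 : EuclideanSpace ℝ (Fin n)) 1 → V} (hφ : Continuous φ) :
    Integrable φ σ :=
  hφ.integrable_of_hasCompactSupport (HasCompactSupport.of_compactSpace φ)

lemma continuous_sphereMap {n : ℕ}
    (e : EuclideanSpace ℝ (Fin n) ≃ₗᵢ[ℝ] EuclideanSpace ℝ (Fin n)) :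
    Continuous (sphereMap e) := by
  unfold sphereMap
  exact Continuous.subtype_mk (e.continuous.comp continuous_subtype_val) _

lemma change_var {n : ℕ} {V : Type*} [NormedAddCommGroup V] [NormedSpace ℝ V]
    [SecondCountableTopology V]
    (σ : Measure (sphere (0 : EuclideanSpace ℝ (Fin n)) 1))
    (hinv : RotationInvariant σ)
    (e : EuclideanSpace ℝ (Fin n) ≃ₗᵢ[ℝ] EuclideanSpace ℝ (Fin n))
    {φ : sphere (0 : EuclideanSpace ℝ (Fin n)) 1 → V} (hφ : Continuous φ) :
    ∫ u, φ (sphereMap e u) ∂σ = ∫ u, φ u ∂σ := by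
  conv_rhs => rw [← hinv e]
  rw [integral_map (continuous_sphereMap e).aemeasurable]
  exact hφ.stronglyMeasurable.aestronglyMeasurable

lemma inner_sphereMap {n : ℕ}
    (e : EuclideanSpace ℝ (Fin n) ≃ₗᵢ[ℝ] EuclideanSpace ℝ (Fin n))
    (u : sphere (0 : EuclideanSpace ℝ (Fin n)) 1) (a b : EuclideanSpace ℝ (Fin n))
    (hab : e a = b) :
    ⟪((sphereMap e u : sphere (0 : EuclideanSpace ℝ (Fin n)) 1) :
      EuclideanSpace ℝ (Fin n)), b⟫ = ⟪(u : EuclideanSpace ℝ (Fin n)), a⟫ := by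
  rw [← hab]
  exact e.inner_map_map _ _

lemma continuous_inner_sphere {n : ℕ} (a : EuclideanSpace ℝ (Fin n)) :
    Continuous (fun u : sphere (0 : EuclideanSpace ℝ (Fin n)) 1 =>
      ⟪(u : EuclideanSpace ℝ (Fin n)), a⟫) :=
  continuous_subtype_val.inner continuous_const

/-- odd part vanishes -/
lemma odd_zero {n : ℕ} (σ : Measure (sphere (0 : EuclideanSpace ℝ (Fin n)) 1))
    (hinv : RotationInvariant σ) (w : EuclideanSpace ℝ (Fin n)) (hw : ‖w‖ = 1)
    (f : ℝ → ℝ)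
    (hf : Continuous (fun u : sphere (0 : EuclideanSpace ℝ (Fin n)) 1 =>
      f ⟪(u : EuclideanSpace ℝ (Fin n)), w⟫)) :
    ∫ u : sphere (0 : EuclideanSpace ℝ (Fin n)) 1,
      f ⟪(u : EuclideanSpace ℝ (Fin n)), w⟫ •
        ((u : EuclideanSpace ℝ (Fin n)) - ⟪(u : EuclideanSpace ℝ (Fin n)), w⟫ • w) ∂σ = 0 := by
  set e := (Submodule.span ℝ {w}).reflection with he
  have hew : e w = w :=
    Submodule.reflection_mem_subspace_eq_self (Submodule.mem_span_singleton_self w)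
  have hcont : Continuous (fun u : sphere (0 : EuclideanSpace ℝ (Fin n)) 1 =>
      f ⟪(u : EuclideanSpace ℝ (Fin n)), w⟫ •
        ((u : EuclideanSpace ℝ (Fin n)) - ⟪(u : EuclideanSpace ℝ (Fin n)), w⟫ • w)) :=
    hf.smul (continuous_subtype_val.sub ((continuous_inner_sphere w).smul continuous_const))
  have h1 := change_var σ hinv e hcont
  have h2 : ∀ u : sphere (0 : EuclideanSpace ℝ (Fin n)) 1,
      ((sphereMap e u : sphere (0 : EuclideanSpace ℝ (Fin n)) 1) : EuclideanSpace ℝ (Fin n))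
        = (2 * ⟪(u : EuclideanSpace ℝ (Fin n)), w⟫) • w - u := by
    intro u
    show e u = _
    rw [he, Submodule.reflection_singleton_apply, hw, real_inner_comm]
    simp [mul_smul, two_smul]
  simp only [inner_sphereMap e _ w w hew] at h1
  simp only [h2] at h1
  have h3 : ∀ u : sphere (0 : EuclideanSpace ℝ (Fin n)) 1,
      f ⟪(u : EuclideanSpace ℝ (Fin n)), w⟫ •
        ((2 * ⟪(u : EuclideanSpace ℝ (Fin n)), w⟫) • w - u
          - ⟪(u : EuclideanSpace ℝ (Fin n)), w⟫ • w) =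
      -(f ⟪(u : EuclideanSpace ℝ (Fin n)), w⟫ •
        ((u : EuclideanSpace ℝ (Fin n)) - ⟪(u : EuclideanSpace ℝ (Fin n)), w⟫ • w)) := by
    intro u
    module
  simp only [h3, integral_neg] at h1
  have h4 := neg_eq_iff_add_eq_zero.mp h1
  rw [← two_smul ℝ] at h4
  exact (smul_eq_zero.mp h4).resolve_left two_ne_zero

lemma quad_eq {n : ℕ} (σ : Measure (sphere (0 : EuclideanSpace ℝ (Fin n)) 1))
    (hinv : RotationInvariant σ) (w : EuclideanSpace ℝ (Fin n))
    (f : ℝ → ℝ)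
    (hf : Continuous (fun u : sphere (0 : EuclideanSpace ℝ (Fin n)) 1 =>
      f ⟪(u : EuclideanSpace ℝ (Fin n)), w⟫))
    (a b : EuclideanSpace ℝ (Fin n)) (ha : ⟪w, a⟫ = 0) (hb : ⟪w, b⟫ = 0) (hab : ‖a‖ = ‖b‖) :
    ∫ u : sphere (0 : EuclideanSpace ℝ (Fin n)) 1,
      f ⟪(u : EuclideanSpace ℝ (Fin n)), w⟫ * ⟪(u : EuclideanSpace ℝ (Fin n)), a⟫ ^ 2 ∂σ =
    ∫ u : sphere (0 : EuclideanSpace ℝ (Fin n)) 1,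
      f ⟪(u : EuclideanSpace ℝ (Fin n)), w⟫ * ⟪(u : EuclideanSpace ℝ (Fin n)), b⟫ ^ 2 ∂σ := by
  set e := (Submodule.span ℝ {a - b})ᗮ.reflection with he
  have hew : e w = w := by
    apply Submodule.reflection_mem_subspace_eq_self
    rw [Submodule.mem_orthogonal_singleton_iff_inner_left, inner_sub_right, ha, hb, sub_zero]
  have hea : e a = b := Submodule.reflection_sub hab
  have h1 := change_var σ hinv e (φ := fun u => f ⟪(u : EuclideanSpace ℝ (Fin n)), w⟫ *
    ⟪(u : EuclideanSpace ℝ (Fin n)), b⟫ ^ 2) (hf.mul ((continuous_inner_sphere b).pow 2))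
  simp only [inner_sphereMap e _ w w hew, inner_sphereMap e _ a b hea] at h1
  exact h1

lemma quad_val {n : ℕ} (hn : 2 ≤ n) (σ : Measure (sphere (0 : EuclideanSpace ℝ (Fin n)) 1))
    [IsProbabilityMeasure σ]
    (hinv : RotationInvariant σ) (w : EuclideanSpace ℝ (Fin n)) (hw : ‖w‖ = 1)
    (f : ℝ → ℝ)
    (hf : Continuous (fun u : sphere (0 : EuclideanSpace ℝ (Fin n)) 1 =>
      f ⟪(u : EuclideanSpace ℝ (Fin n)), w⟫))
    (a : EuclideanSpace ℝ (Fin n)) (ha : ⟪w, a⟫ = 0) :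
    ((n : ℝ) - 1) * ∫ u : sphere (0 : EuclideanSpace ℝ (Fin n)) 1,
      f ⟪(u : EuclideanSpace ℝ (Fin n)), w⟫ * ⟪(u : EuclideanSpace ℝ (Fin n)), a⟫ ^ 2 ∂σ =
    ‖a‖ ^ 2 * ∫ u : sphere (0 : EuclideanSpace ℝ (Fin n)) 1,
      f ⟪(u : EuclideanSpace ℝ (Fin n)), w⟫ *
        (1 - ⟪(u : EuclideanSpace ℝ (Fin n)), w⟫ ^ 2) ∂σ := by
  obtain ⟨m, rfl⟩ : ∃ m, n = m + 1 := ⟨n - 1, by omega⟩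
  have hfr : Module.finrank ℝ (Submodule.span ℝ {w})ᗮ = m := by
    have : Fact (Module.finrank ℝ (EuclideanSpace ℝ (Fin (m + 1))) = m + 1) := ⟨by simp⟩
    exact Submodule.finrank_orthogonal_span_singleton (by rintro rfl; simp at hw)
  let b := (stdOrthonormalBasis ℝ (Submodule.span ℝ {w})ᗮ).reindex (finCongr hfr)
  have hb0 : ∀ i, ⟪w, (b i : EuclideanSpace ℝ (Fin (m + 1)))⟫ = 0 := fun i =>
    Submodule.mem_orthogonal_singleton_iff_inner_right.mp (b i).2
  have hb1 : ∀ i, ‖(b i : EuclideanSpace ℝ (Fin (m + 1)))‖ = 1 := fun i =>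
    b.orthonormal.1 i
  have hsum : ∀ u : sphere (0 : EuclideanSpace ℝ (Fin (m + 1))) 1,
      ∑ i, ⟪(u : EuclideanSpace ℝ (Fin (m + 1))), (b i : EuclideanSpace ℝ (Fin (m + 1)))⟫ ^ 2
        = 1 - ⟪(u : EuclideanSpace ℝ (Fin (m + 1))), w⟫ ^ 2 := by
    intro u
    have hu : ‖(u : EuclideanSpace ℝ (Fin (m + 1)))‖ = 1 := mem_sphere_zero_iff_norm.mp u.2
    set p : EuclideanSpace ℝ (Fin (m + 1)) :=
      u - ⟪(u : EuclideanSpace ℝ (Fin (m + 1))), w⟫ • w with hp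
    have hpm : p ∈ (Submodule.span ℝ {w})ᗮ := by
      rw [Submodule.mem_orthogonal_singleton_iff_inner_right, hp, inner_sub_right,
        inner_smul_right, real_inner_self_eq_norm_sq, hw, real_inner_comm]
      ring
    have h1 := b.sum_sq_norm_inner_left ⟨p, hpm⟩
    have h2 : ‖p‖ ^ 2 = 1 - ⟪(u : EuclideanSpace ℝ (Fin (m + 1))), w⟫ ^ 2 := by
      rw [hp, norm_sub_sq_real, inner_smul_right, norm_smul, hw, hu, Real.norm_eq_abs, mul_one,
        sq_abs]
      ring
    rw [← h2]
    refine Eq.trans ?_ h1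
    refine Finset.sum_congr rfl fun i _ => ?_
    rw [Real.norm_eq_abs, sq_abs, Submodule.coe_inner]
    simp only [hp, inner_sub_left, inner_smul_left, hb0]
    simp
  have hi : ∀ i, ∫ u : sphere (0 : EuclideanSpace ℝ (Fin (m + 1))) 1,
      f ⟪(u : EuclideanSpace ℝ (Fin (m + 1))), w⟫ *
        ⟪(u : EuclideanSpace ℝ (Fin (m + 1))), a⟫ ^ 2 ∂σ =
      ‖a‖ ^ 2 * ∫ u : sphere (0 : EuclideanSpace ℝ (Fin (m + 1))) 1,
      f ⟪(u : EuclideanSpace ℝ (Fin (m + 1))), w⟫ *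
        ⟪(u : EuclideanSpace ℝ (Fin (m + 1))), (b i : EuclideanSpace ℝ (Fin (m + 1)))⟫ ^ 2 ∂σ := by
    intro i
    rw [quad_eq σ hinv w f hf a (‖a‖ • (b i : EuclideanSpace ℝ (Fin (m + 1)))) ha
      (by rw [inner_smul_right, hb0, mul_zero]) (by rw [norm_smul, hb1]; simp),
      ← integral_const_mul]
    congr 1
    ext u
    rw [inner_smul_right]
    ring
  have hs : ∑ i : Fin m, ∫ u : sphere (0 : EuclideanSpace ℝ (Fin (m + 1))) 1,
      f ⟪(u : EuclideanSpace ℝ (Fin (m + 1))), w⟫ *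
        ⟪(u : EuclideanSpace ℝ (Fin (m + 1))), (b i : EuclideanSpace ℝ (Fin (m + 1)))⟫ ^ 2 ∂σ =
      ∫ u : sphere (0 : EuclideanSpace ℝ (Fin (m + 1))) 1,
      f ⟪(u : EuclideanSpace ℝ (Fin (m + 1))), w⟫ *
        (1 - ⟪(u : EuclideanSpace ℝ (Fin (m + 1))), w⟫ ^ 2) ∂σ := by
    rw [← integral_finsetSum]
    · congr 1
      ext u
      rw [← Finset.mul_sum, hsum]
    · intro i _
      exact integrable_cont σ (hf.mul ((continuous_inner_sphere _).pow 2))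
  rw [← hs, Finset.mul_sum, ← Finset.sum_congr rfl (fun i _ => hi i)]
  simp

lemma bilin_val {n : ℕ} (hn : 2 ≤ n) (σ : Measure (sphere (0 : EuclideanSpace ℝ (Fin n)) 1))
    [IsProbabilityMeasure σ]
    (hinv : RotationInvariant σ) (w : EuclideanSpace ℝ (Fin n)) (hw : ‖w‖ = 1)
    (f : ℝ → ℝ)
    (hf : Continuous (fun u : sphere (0 : EuclideanSpace ℝ (Fin n)) 1 =>
      f ⟪(u : EuclideanSpace ℝ (Fin n)), w⟫))
    (a b : EuclideanSpace ℝ (Fin n)) (ha : ⟪w, a⟫ = 0) (hb : ⟪w, b⟫ = 0) :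
    ((n : ℝ) - 1) * ∫ u : sphere (0 : EuclideanSpace ℝ (Fin n)) 1,
      f ⟪(u : EuclideanSpace ℝ (Fin n)), w⟫ * (⟪(u : EuclideanSpace ℝ (Fin n)), a⟫ *
        ⟪(u : EuclideanSpace ℝ (Fin n)), b⟫) ∂σ =
    ⟪a, b⟫ * ∫ u : sphere (0 : EuclideanSpace ℝ (Fin n)) 1,
      f ⟪(u : EuclideanSpace ℝ (Fin n)), w⟫ *
        (1 - ⟪(u : EuclideanSpace ℝ (Fin n)), w⟫ ^ 2) ∂σ := by
  have h1 := quad_val hn σ hinv w hw f hf (a + b) (by rw [inner_add_right, ha, hb, add_zero])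
  have h2 := quad_val hn σ hinv w hw f hf (a - b) (by rw [inner_sub_right, ha, hb, sub_zero])
  rw [norm_add_sq_real] at h1
  rw [norm_sub_sq_real] at h2
  have h3 : ∫ u : sphere (0 : EuclideanSpace ℝ (Fin n)) 1,
      f ⟪(u : EuclideanSpace ℝ (Fin n)), w⟫ * (⟪(u : EuclideanSpace ℝ (Fin n)), a⟫ *
        ⟪(u : EuclideanSpace ℝ (Fin n)), b⟫) ∂σ = (1 / 4) *
      ((∫ u : sphere (0 : EuclideanSpace ℝ (Fin n)) 1,
      f ⟪(u : EuclideanSpace ℝ (Fin n)), w⟫ * ⟪(u : EuclideanSpace ℝ (Fin n)), a + b⟫ ^ 2 ∂σ) -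
      ∫ u : sphere (0 : EuclideanSpace ℝ (Fin n)) 1,
      f ⟪(u : EuclideanSpace ℝ (Fin n)), w⟫ * ⟪(u : EuclideanSpace ℝ (Fin n)), a - b⟫ ^ 2 ∂σ) := by
    rw [← integral_sub, ← integral_const_mul]
    · congr 1
      ext u
      rw [inner_add_right, inner_sub_right]
      ring
    · exact integrable_cont σ (hf.mul ((continuous_inner_sphere _).pow 2))
    · exact integrable_cont σ (hf.mul ((continuous_inner_sphere _).pow 2))
  rw [h3]
  linear_combination (1 / 4) * h1 - (1 / 4) * h2

lemma vec_val {n : ℕ} (hn : 2 ≤ n) (σ : Measure (sphere (0 : EuclideanSpace ℝ (Fin n)) 1))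
    [IsProbabilityMeasure σ]
    (hinv : RotationInvariant σ) (w : EuclideanSpace ℝ (Fin n)) (hw : ‖w‖ = 1)
    (f : ℝ → ℝ)
    (hf : Continuous (fun u : sphere (0 : EuclideanSpace ℝ (Fin n)) 1 =>
      f ⟪(u : EuclideanSpace ℝ (Fin n)), w⟫))
    (a : EuclideanSpace ℝ (Fin n)) (ha : ⟪w, a⟫ = 0) :
    ∫ u : sphere (0 : EuclideanSpace ℝ (Fin n)) 1,
      (f ⟪(u : EuclideanSpace ℝ (Fin n)), w⟫ * ⟪(u : EuclideanSpace ℝ (Fin n)), a⟫) •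
        ((u : EuclideanSpace ℝ (Fin n)) - ⟪(u : EuclideanSpace ℝ (Fin n)), w⟫ • w) ∂σ =
    ((∫ u : sphere (0 : EuclideanSpace ℝ (Fin n)) 1,
      f ⟪(u : EuclideanSpace ℝ (Fin n)), w⟫ *
        (1 - ⟪(u : EuclideanSpace ℝ (Fin n)), w⟫ ^ 2) ∂σ) / ((n : ℝ) - 1)) • a := by
  have hn1 : (n : ℝ) - 1 ≠ 0 := by
    have : (2 : ℝ) ≤ n := by exact_mod_cast hn
    linarith
  refine ext_inner_left ℝ fun v => ?_
  rw [← integral_inner]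
  swap
  · exact integrable_cont σ ((hf.mul (continuous_inner_sphere a)).smul
      (continuous_subtype_val.sub ((continuous_inner_sphere w).smul continuous_const)))
  have h1 := bilin_val hn σ hinv w hw f hf a (v - ⟪v, w⟫ • w) ha (by
    rw [inner_sub_right, inner_smul_right, real_inner_self_eq_norm_sq, hw, real_inner_comm]
    ring)
  have h2 : ∀ u : sphere (0 : EuclideanSpace ℝ (Fin n)) 1,
      ⟪v, (f ⟪(u : EuclideanSpace ℝ (Fin n)), w⟫ * ⟪(u : EuclideanSpace ℝ (Fin n)), a⟫) •
        ((u : EuclideanSpace ℝ (Fin n)) - ⟪(u : EuclideanSpace ℝ (Fin n)), w⟫ • w)⟫ =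
      f ⟪(u : EuclideanSpace ℝ (Fin n)), w⟫ * (⟪(u : EuclideanSpace ℝ (Fin n)), a⟫ *
        ⟪(u : EuclideanSpace ℝ (Fin n)), v - ⟪v, w⟫ • w⟫) := by
    intro u
    rw [inner_smul_right, inner_sub_right, inner_sub_right, inner_smul_right, inner_smul_right,
      real_inner_comm (u : EuclideanSpace ℝ (Fin n)) v]
    ring
  simp only [h2]
  rw [inner_smul_right]
  have h3 : ⟪a, v - ⟪v, w⟫ • w⟫ = ⟪v, a⟫ := by
    rw [inner_sub_right, inner_smul_right, real_inner_comm w a, ha, real_inner_comm]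
    ring
  rw [h3] at h1
  rw [div_mul_eq_mul_div, eq_div_iff hn1]
  linarith

/-- The partition function depends only on `η`. -/
lemma part_eq {n : ℕ} (σ : Measure (sphere (0 : EuclideanSpace ℝ (Fin n)) 1))
    (hinv : RotationInvariant σ) (w w' : EuclideanSpace ℝ (Fin n)) (hw : ‖w‖ = ‖w'‖) (t : ℝ) :
    ∫ v : sphere (0 : EuclideanSpace ℝ (Fin n)) 1,
      Real.exp (t * ⟪(v : EuclideanSpace ℝ (Fin n)), w⟫ ^ 2) ∂σ =
    ∫ v : sphere (0 : EuclideanSpace ℝ (Fin n)) 1,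
      Real.exp (t * ⟪(v : EuclideanSpace ℝ (Fin n)), w'⟫ ^ 2) ∂σ := by
  have h1 := change_var σ hinv ((Submodule.span ℝ {w - w'})ᗮ.reflection)
    (φ := fun v => Real.exp (t * ⟪(v : EuclideanSpace ℝ (Fin n)), w'⟫ ^ 2))
    (Real.continuous_exp.comp (continuous_const.mul ((continuous_inner_sphere w').pow 2)))
  simp only [inner_sphereMap _ _ w w' (Submodule.reflection_sub hw)] at h1
  exact h1

lemma part_diff {n : ℕ} (σ : Measure (sphere (0 : EuclideanSpace ℝ (Fin n)) 1))
    [IsProbabilityMeasure σ] (w : EuclideanSpace ℝ (Fin n)) :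
    Differentiable ℝ (fun t : ℝ => ∫ v : sphere (0 : EuclideanSpace ℝ (Fin n)) 1,
      Real.exp (t * ⟪(v : EuclideanSpace ℝ (Fin n)), w⟫ ^ 2) ∂σ) := by
  intro t
  have h : ProbabilityTheory.integrableExpSet
      (fun v : sphere (0 : EuclideanSpace ℝ (Fin n)) 1 =>
        ⟪(v : EuclideanSpace ℝ (Fin n)), w⟫ ^ 2) σ = Set.univ := by
    ext s
    simp only [ProbabilityTheory.integrableExpSet, Set.mem_ofPred_eq, Set.mem_univ, iff_true]
    exact integrable_cont σ
      (Real.continuous_exp.comp (continuous_const.mul ((continuous_inner_sphere w).pow 2)))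
  exact ProbabilityTheory.differentiableAt_mgf (by rw [h]; simp)

lemma part_pos {n : ℕ} (σ : Measure (sphere (0 : EuclideanSpace ℝ (Fin n)) 1))
    [IsProbabilityMeasure σ] (w : EuclideanSpace ℝ (Fin n)) (t : ℝ) :
    0 < ∫ v : sphere (0 : EuclideanSpace ℝ (Fin n)) 1,
      Real.exp (t * ⟪(v : EuclideanSpace ℝ (Fin n)), w⟫ ^ 2) ∂σ :=
  integral_exp_pos (integrable_cont σ
      (Real.continuous_exp.comp (continuous_const.mul ((continuous_inner_sphere w).pow 2))))

lemma pd_calc {n : ℕ} (j : Fin n) (p r k q Z : EuclideanSpace ℝ (Fin n) → ℝ)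
    (x : EuclideanSpace ℝ (Fin n)) (hp : DifferentiableAt ℝ p x) (hr : DifferentiableAt ℝ r x)
    (hk : DifferentiableAt ℝ k x) (hq : DifferentiableAt ℝ q x) (hZ : DifferentiableAt ℝ Z x)
    (hZ0 : Z x ≠ 0) :
    pd j (fun y => p y * r y * (Real.exp (k y * q y ^ 2) / Z y)) x =
      (Real.exp (k x * q x ^ 2) / Z x) *
        ((pd j p x * r x + p x * pd j r x - p x * r x * pd j Z x / Z x)
          + p x * r x * pd j k x * q x ^ 2)
      + 2 * k x * r x * (q x * (Real.exp (k x * q x ^ 2) / Z x)) * (p x * pd j q x) := by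
  have h := (hp.hasFDerivAt.mul hr.hasFDerivAt).mul
    ((hk.hasFDerivAt.mul (hq.hasFDerivAt.pow 2)).exp.mul ((hasDerivAt_inv hZ0).comp_hasFDerivAt x hZ.hasFDerivAt))
  have h' := h.fderiv
  unfold pd
  refine (congrArg (fun L => L (EuclideanSpace.single j 1)) h').trans ?_
  simp
  field_simp
  ring

end DivAux

/-- The term `I₃ = ∫ ∇_x·((∇_xρ) ρ G_{η(ρ)A_Ω}) ψ dσ = (2ρη c₁₂/(n−1)) (∇_xρ·∇_x)Ω`,
where `ψ = h(u·Ω) P_{Ω⊥}u` is the Generalized Collision Invariant with `h` odd. -/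
theorem divergence_I3 (n : ℕ) (hn : 2 ≤ n)
    (σ : Measure (sphere (0 : EuclideanSpace ℝ (Fin n)) 1))
    (hprob : IsProbabilityMeasure σ) (hinv : RotationInvariant σ)
    (ρ : EuclideanSpace ℝ (Fin n) → ℝ) (hρ : ContDiff ℝ 2 ρ)
    (η : ℝ → ℝ) (hη : ContDiff ℝ 1 η)
    (Ω : EuclideanSpace ℝ (Fin n) → EuclideanSpace ℝ (Fin n)) (hΩdiff : ContDiff ℝ 1 Ω)
    (hΩ : ∀ x, ‖Ω x‖ = 1)
    (h : ℝ → ℝ) (hcont : ContinuousOn h (Set.Icc (-1) 1))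
    (hodd : ∀ r ∈ Set.Icc (-1 : ℝ) 1, h (-r) = -h r) :
    ∀ x : EuclideanSpace ℝ (Fin n),
      (∫ u : sphere (0 : EuclideanSpace ℝ (Fin n)) 1,
          (∑ j : Fin n,
              pd j (fun y => pd j ρ y * ρ y * gibbs σ (η (ρ y)) (Ω y) u) x) •
            (h ⟪(u : EuclideanSpace ℝ (Fin n)), Ω x⟫ •
              ((u : EuclideanSpace ℝ (Fin n))
                - ⟪(u : EuclideanSpace ℝ (Fin n)), Ω x⟫ • Ω x)) ∂σ)
        = ((2 * η (ρ x) *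
              ∫ u : sphere (0 : EuclideanSpace ℝ (Fin n)) 1,
                ⟪(u : EuclideanSpace ℝ (Fin n)), Ω x⟫ *
                  h ⟪(u : EuclideanSpace ℝ (Fin n)), Ω x⟫ *
                  (1 - ⟪(u : EuclideanSpace ℝ (Fin n)), Ω x⟫ ^ 2) *
                  gibbs σ (η (ρ x)) (Ω x) u ∂σ) /
            ((n : ℝ) - 1)) •
          (ρ x • ∑ j : Fin n, pd j ρ x • pdV j Ω x) := by
  intro x
  have hZd : DifferentiableAt ℝ (fun y => ∫ v : sphere (0 : EuclideanSpace ℝ (Fin n)) 1,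
      Real.exp (η (ρ y) * ⟪(v : EuclideanSpace ℝ (Fin n)), Ω y⟫ ^ 2) ∂σ) x := by
    have : (fun y => ∫ v : sphere (0 : EuclideanSpace ℝ (Fin n)) 1,
      Real.exp (η (ρ y) * ⟪(v : EuclideanSpace ℝ (Fin n)), Ω y⟫ ^ 2) ∂σ) =
      (fun t : ℝ => ∫ v : sphere (0 : EuclideanSpace ℝ (Fin n)) 1,
      Real.exp (t * ⟪(v : EuclideanSpace ℝ (Fin n)), Ω x⟫ ^ 2) ∂σ) ∘ (fun y => η (ρ y)) := by
      ext y
      exact DivAux.part_eq σ hinv (Ω y) (Ω x) (by rw [hΩ, hΩ]) _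
    rw [this]
    refine (DivAux.part_diff σ (Ω x) _).comp x ?_
    exact ((hη.differentiable one_ne_zero) _).comp x ((hρ.differentiable two_ne_zero) x)
  have hρd : DifferentiableAt ℝ ρ x := (hρ.differentiable two_ne_zero) x
  have hkd : DifferentiableAt ℝ (fun y => η (ρ y)) x :=
    ((hη.differentiable one_ne_zero) _).comp x hρd
  have hΩd : DifferentiableAt ℝ Ω x := (hΩdiff.differentiable one_ne_zero) x
  have hpdd : ∀ j, DifferentiableAt ℝ (fun y => pd j ρ y) x := by
    intro j
    have h1 : ContDiff ℝ 1 (fderiv ℝ ρ) := hρ.fderiv_right (by norm_num)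
    exact ((h1.differentiable one_ne_zero) x).clm_apply (differentiableAt_const _)
  have hperp : ∀ j, ⟪Ω x, pdV j Ω x⟫ = 0 := by
    intro j
    have h1 : HasFDerivAt (fun y => ⟪Ω y, Ω y⟫) _ x := hΩd.hasFDerivAt.inner ℝ hΩd.hasFDerivAt
    have h2 : (fun y => ⟪Ω y, Ω y⟫) = fun _ => (1 : ℝ) := by
      ext y
      rw [real_inner_self_eq_norm_sq, hΩ]
      norm_num
    rw [h2] at h1
    have h3 := h1.unique (hasFDerivAt_const (1 : ℝ) x)
    have h4 := congrArg (fun L => L (EuclideanSpace.single j 1)) h3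
    simp [fderivInnerCLM_apply] at h4
    rw [real_inner_comm (Ω x) (fderiv ℝ Ω x _)] at h4
    unfold pdV
    linarith
  set Z : EuclideanSpace ℝ (Fin n) → ℝ := fun y =>
    ∫ v : sphere (0 : EuclideanSpace ℝ (Fin n)) 1,
      Real.exp (η (ρ y) * ⟪(v : EuclideanSpace ℝ (Fin n)), Ω y⟫ ^ 2) ∂σ with hZ
  have hZ0 : Z x ≠ 0 := (DivAux.part_pos σ (Ω x) (η (ρ x))).ne'
  set A : EuclideanSpace ℝ (Fin n) := ∑ j : Fin n, pd j ρ x • pdV j Ω x with hA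
  have hA0 : ⟪Ω x, A⟫ = 0 := by
    rw [hA, inner_sum]
    refine Finset.sum_eq_zero fun j _ => ?_
    rw [inner_smul_right, hperp, mul_zero]
  obtain ⟨c0, c1, hsum⟩ : ∃ c0 c1 : ℝ, ∀ u : sphere (0 : EuclideanSpace ℝ (Fin n)) 1,
      (∑ j : Fin n, pd j (fun y => pd j ρ y * ρ y * gibbs σ (η (ρ y)) (Ω y) u) x) =
      (Real.exp (η (ρ x) * ⟪(u : EuclideanSpace ℝ (Fin n)), Ω x⟫ ^ 2) / Z x) *
        (c0 + c1 * ⟪(u : EuclideanSpace ℝ (Fin n)), Ω x⟫ ^ 2) +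
      2 * η (ρ x) * ρ x * (⟪(u : EuclideanSpace ℝ (Fin n)), Ω x⟫ *
        (Real.exp (η (ρ x) * ⟪(u : EuclideanSpace ℝ (Fin n)), Ω x⟫ ^ 2) / Z x)) *
        ⟪(u : EuclideanSpace ℝ (Fin n)), A⟫ := by
    refine ⟨∑ j, (pd j (fun y => pd j ρ y) x * ρ x + pd j ρ x * pd j ρ x
      - pd j ρ x * ρ x * pd j Z x / Z x),
      ∑ j, pd j ρ x * ρ x * pd j (fun y => η (ρ y)) x, fun u => ?_⟩
    have hqd : DifferentiableAt ℝ (fun y => ⟪(u : EuclideanSpace ℝ (Fin n)), Ω y⟫) x :=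
      (differentiableAt_const _).inner ℝ hΩd
    have hq' : ∀ j, pd j (fun y => ⟪(u : EuclideanSpace ℝ (Fin n)), Ω y⟫) x =
        ⟪(u : EuclideanSpace ℝ (Fin n)), pdV j Ω x⟫ := by
      intro j
      unfold pd pdV
      rw [fderiv_inner_apply ℝ (differentiableAt_const _) hΩd]
      simp
    have hj := fun j => DivAux.pd_calc j (fun y => pd j ρ y) ρ (fun y => η (ρ y))
      (fun y => ⟪(u : EuclideanSpace ℝ (Fin n)), Ω y⟫) Z x (hpdd j) hρd hkd hqd hZd hZ0
    refine (Finset.sum_congr rfl fun j _ => hj j).trans ?_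
    simp only [hq']
    rw [Finset.sum_add_distrib, ← Finset.mul_sum, ← Finset.mul_sum, Finset.sum_add_distrib,
      ← Finset.sum_mul, hA, inner_sum]
    simp only [inner_smul_right]
  have hhc : Continuous (fun u : sphere (0 : EuclideanSpace ℝ (Fin n)) 1 =>
      h ⟪(u : EuclideanSpace ℝ (Fin n)), Ω x⟫) := by
    refine hcont.comp_continuous (DivAux.continuous_inner_sphere (Ω x)) fun u => ?_
    have hu : ‖(u : EuclideanSpace ℝ (Fin n))‖ = 1 := mem_sphere_zero_iff_norm.mp u.2
    have := abs_real_inner_le_norm (u : EuclideanSpace ℝ (Fin n)) (Ω x)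
    rw [hu, hΩ, mul_one] at this
    exact abs_le.mp this
  have hsc := DivAux.continuous_inner_sphere (Ω x)
  have hGc : Continuous (fun u : sphere (0 : EuclideanSpace ℝ (Fin n)) 1 =>
      Real.exp (η (ρ x) * ⟪(u : EuclideanSpace ℝ (Fin n)), Ω x⟫ ^ 2) / Z x) :=
    (Real.continuous_exp.comp (continuous_const.mul (hsc.pow 2))).div_const _
  let f1 : ℝ → ℝ := fun s => (Real.exp (η (ρ x) * s ^ 2) / Z x) * (c0 + c1 * s ^ 2) * h s
  let f2 : ℝ → ℝ := fun s => s * h s * (Real.exp (η (ρ x) * s ^ 2) / Z x)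
  have hf1 : Continuous (fun u : sphere (0 : EuclideanSpace ℝ (Fin n)) 1 =>
      f1 ⟪(u : EuclideanSpace ℝ (Fin n)), Ω x⟫) :=
    (hGc.mul (continuous_const.add (continuous_const.mul (hsc.pow 2)))).mul hhc
  have hf2 : Continuous (fun u : sphere (0 : EuclideanSpace ℝ (Fin n)) 1 =>
      f2 ⟪(u : EuclideanSpace ℝ (Fin n)), Ω x⟫) := (hsc.mul hhc).mul hGc
  have hPc : Continuous (fun u : sphere (0 : EuclideanSpace ℝ (Fin n)) 1 =>
      (u : EuclideanSpace ℝ (Fin n)) - ⟪(u : EuclideanSpace ℝ (Fin n)), Ω x⟫ • Ω x) :=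
    continuous_subtype_val.sub (hsc.smul continuous_const)
  have e1 := DivAux.odd_zero σ hinv (Ω x) (hΩ x) f1 hf1
  have e2 := DivAux.vec_val hn σ hinv (Ω x) (hΩ x) f2 hf2 A hA0
  have hint : ∀ u : sphere (0 : EuclideanSpace ℝ (Fin n)) 1,
      (∑ j : Fin n, pd j (fun y => pd j ρ y * ρ y * gibbs σ (η (ρ y)) (Ω y) u) x) •
            (h ⟪(u : EuclideanSpace ℝ (Fin n)), Ω x⟫ •
              ((u : EuclideanSpace ℝ (Fin n))
                - ⟪(u : EuclideanSpace ℝ (Fin n)), Ω x⟫ • Ω x)) =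
      f1 ⟪(u : EuclideanSpace ℝ (Fin n)), Ω x⟫ • ((u : EuclideanSpace ℝ (Fin n))
                - ⟪(u : EuclideanSpace ℝ (Fin n)), Ω x⟫ • Ω x) +
      (2 * η (ρ x) * ρ x) • ((f2 ⟪(u : EuclideanSpace ℝ (Fin n)), Ω x⟫ *
        ⟪(u : EuclideanSpace ℝ (Fin n)), A⟫) • ((u : EuclideanSpace ℝ (Fin n))
                - ⟪(u : EuclideanSpace ℝ (Fin n)), Ω x⟫ • Ω x)) := by
    intro u
    rw [hsum u, smul_smul, smul_smul, ← add_smul]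
    congr 1
    simp only [f1, f2]
    ring
  rw [integral_congr_ae (Filter.Eventually.of_forall hint), integral_add, integral_smul, e1, e2,
    zero_add, smul_smul, smul_smul]
  · congr 1
    have hI : ∫ u : sphere (0 : EuclideanSpace ℝ (Fin n)) 1,
        ⟪(u : EuclideanSpace ℝ (Fin n)), Ω x⟫ *
          h ⟪(u : EuclideanSpace ℝ (Fin n)), Ω x⟫ *
          (1 - ⟪(u : EuclideanSpace ℝ (Fin n)), Ω x⟫ ^ 2) *
          gibbs σ (η (ρ x)) (Ω x) u ∂σ =
        ∫ u : sphere (0 : EuclideanSpace ℝ (Fin n)) 1,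
          f2 ⟪(u : EuclideanSpace ℝ (Fin n)), Ω x⟫ *
            (1 - ⟪(u : EuclideanSpace ℝ (Fin n)), Ω x⟫ ^ 2) ∂σ := by
      congr 1
      ext u
      simp only [f2, gibbs, hZ]
      ring
    rw [hI]
    ring
  · exact DivAux.integrable_cont σ (hf1.smul hPc)
  · have hc := ((hf2.mul (DivAux.continuous_inner_sphere A)).smul hPc).const_smul
      (2 * η (ρ x) * ρ x)
    exact DivAux.integrable_cont σ hc
end
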